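/- A game matrix k : Fin n_A → Fin n_B → ZMod d (n_A, n_B ≥ 2) has the maximal contradiction number, β_C(k) = (n_A − 1)(n_B − 1), if and only if k contains no good cycle: there is no l ≥ 2, no pairwise distinct rows i₁,…,i_l and no pairwise distinct columns j₁,…,j_l with k(i₁,j₁) + k(i₂,j₂) + ⋯ + k(i_l,j_l) = k(i₂,j₁) + k(i₃,j₂) + ⋯ + k(i₁,j_l) in ZMod d. -/

import Mathlib

/-- The number of contradictions of the classical strategy `(a, b)` for the game matrix `k`. -/
def numContr {nA nB d : ℕ} (k : Fin nA → Fin nB → ZMod d)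
    (a : Fin nA → ZMod d) (b : Fin nB → ZMod d) : ℕ :=
  ((Finset.univ : Finset (Fin nA × Fin nB)).filter
    (fun p => b p.2 ≠ a p.1 + k p.1 p.2)).card

/-- The contradiction number `β_C(k)`: the minimum number of contradictions over all
classical strategies. -/
noncomputable def betaC {nA nB d : ℕ} (k : Fin nA → Fin nB → ZMod d) : ℕ :=
  sInf { m | ∃ (a : Fin nA → ZMod d) (b : Fin nB → ZMod d), numContr k a b = m }

/-- A bipartite relation in which some walk without backtracking never stops contains a cycle. -/
theorem exists_cycle_of_walk {α β : Type*} [Finite α] {E : α → β → Prop} (x : ℕ → α) (y : ℕ → β)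
    (hxy : ∀ n, E (x n) (y n)) (hyx : ∀ n, E (x (n + 1)) (y n))
    (hx : ∀ n, x n ≠ x (n + 1)) (hy : ∀ n, y n ≠ y (n + 1)) :
    ∃ (l : ℕ) (hl : 2 ≤ l) (i : Fin l → α) (j : Fin l → β),
      Function.Injective i ∧ Function.Injective j ∧
      ∀ t, E (i t) (j t) ∧ E (i (t + ⟨1, by omega⟩)) (j t) := by
  classical
  have hex : ∃ l, 0 < l ∧ ∃ p, x p = x (p + l) ∨ y p = y (p + l) := by
    obtain ⟨m, n, hmn, h⟩ := Finite.exists_ne_map_eq_of_infinite x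
    rcases lt_or_gt_of_ne hmn with hlt | hlt
    · exact ⟨n - m, by omega, m, Or.inl (by rw [h]; congr 1; omega)⟩
    · exact ⟨m - n, by omega, n, Or.inl (by rw [← h]; congr 1; omega)⟩
  obtain ⟨l, ⟨hpos, p, hp⟩, hmin⟩ : ∃ l, (0 < l ∧ ∃ p, x p = x (p + l) ∨ y p = y (p + l)) ∧
      ∀ m < l, ¬ (0 < m ∧ ∃ p, x p = x (p + m) ∨ y p = y (p + m)) :=
    ⟨Nat.find hex, Nat.find_spec hex, fun _ => Nat.find_min hex⟩
  have hl : 2 ≤ l := by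
    by_contra hlt
    obtain rfl : l = 1 := by omega
    exact hp.elim (hx p) (hy p)
  have hdist : ∀ m n, m < n → n < m + l → x m ≠ x n ∧ y m ≠ y n := by
    intro m n hmn hnl
    have h := hmin (n - m) (by omega)
    have hn : m + (n - m) = n := by omega
    exact ⟨fun e => h ⟨by omega, m, Or.inl (by rwa [hn])⟩,
      fun e => h ⟨by omega, m, Or.inr (by rwa [hn])⟩⟩
  have hxinj : ∀ q, Function.Injective fun t : Fin l => x (q + t) := by
    intro q s t h
    by_contra hne
    have hne' : (s : ℕ) ≠ t := fun e => hne (Fin.ext e)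
    rcases lt_or_gt_of_ne hne' with hlt | hlt
    · exact (hdist (q + s) (q + t) (by omega) (by omega)).1 h
    · exact (hdist (q + t) (q + s) (by omega) (by omega)).1 h.symm
  have hyinj : ∀ q, Function.Injective fun t : Fin l => y (q + t) := by
    intro q s t h
    by_contra hne
    have hne' : (s : ℕ) ≠ t := fun e => hne (Fin.ext e)
    rcases lt_or_gt_of_ne hne' with hlt | hlt
    · exact (hdist (q + s) (q + t) (by omega) (by omega)).2 h
    · exact (hdist (q + t) (q + s) (by omega) (by omega)).2 h.symm
  obtain ⟨q, hq⟩ : ∃ q, E (x q) (y (q + (l - 1))) := by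
    rcases hp with hp | hp
    · refine ⟨p, ?_⟩
      rw [hp]
      convert hyx (p + (l - 1)) using 2
      omega
    · refine ⟨p + 1, ?_⟩
      rw [show p + 1 + (l - 1) = p + l by omega, ← hp]
      exact hyx p
  refine ⟨l, hl, fun t => x (q + t), fun t => y (q + t), hxinj q, hyinj q, fun t => ⟨hxy _, ?_⟩⟩
  dsimp only
  rw [Fin.val_add]
  dsimp only
  by_cases ht : (t : ℕ) + 1 < l
  · rw [Nat.mod_eq_of_lt ht]
    exact hyx (q + t)
  · have ht' : (t : ℕ) = l - 1 := by omega
    rw [ht', show l - 1 + 1 = l by omega, Nat.mod_self]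
    exact hq

/-- A nonempty finite bipartite graph in which no vertex has degree one contains a cycle. -/
theorem exists_cycle_of_no_leaf {α β : Type*} {S : Finset (α × β)} [Finite α] (hS : S.Nonempty)
    (hrow : ∀ p ∈ S, ∃ y, y ≠ p.2 ∧ (p.1, y) ∈ S) (hcol : ∀ p ∈ S, ∃ x, x ≠ p.1 ∧ (x, p.2) ∈ S) :
    ∃ (l : ℕ) (hl : 2 ≤ l) (i : Fin l → α) (j : Fin l → β),
      Function.Injective i ∧ Function.Injective j ∧
      ∀ t, (i t, j t) ∈ S ∧ (i (t + ⟨1, by omega⟩), j t) ∈ S := by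
  obtain ⟨e, he⟩ := hS
  choose r hr hrS using hrow
  choose c hc hcS using hcol
  let next : S → S := fun p => ⟨(c p p.2, r _ (hcS p p.2)), hrS _ (hcS p p.2)⟩
  let w : ℕ → S := fun n => next^[n] ⟨e, he⟩
  have hw : ∀ n, w (n + 1) = next (w n) := fun n => Function.iterate_succ_apply' next n _
  refine exists_cycle_of_walk (E := fun x y => (x, y) ∈ S)
    (fun n => (w n).1.1) (fun n => (w n).1.2) (fun n => (w n).2) ?_ ?_ ?_
  · intro n
    simp only [hw]
    exact hcS _ (w n).2
  · intro n
    simp only [hw]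
    exact (hc _ (w n).2).symm
  · intro n
    simp only [hw]
    exact (hr _ (hcS _ (w n).2)).symm

/-- A nonempty finite bipartite graph with at least as many edges as nonisolated vertices contains
a cycle. -/
theorem exists_cycle_of_card_le {α β : Type*} [DecidableEq α] [DecidableEq β] [Finite α]
    (S : Finset (α × β)) (hS : S.Nonempty)
    (hcard : (S.image Prod.fst).card + (S.image Prod.snd).card ≤ S.card) :
    ∃ (l : ℕ) (hl : 2 ≤ l) (i : Fin l → α) (j : Fin l → β),
      Function.Injective i ∧ Function.Injective j ∧
      ∀ t, (i t, j t) ∈ S ∧ (i (t + ⟨1, by omega⟩), j t) ∈ S := by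
  induction S using Finset.strongInduction with
  | H S ih =>
    have herase : ∀ p ∈ S,
        ((S.erase p).image Prod.fst).card + ((S.erase p).image Prod.snd).card <
          (S.image Prod.fst).card + (S.image Prod.snd).card →
        ∃ (l : ℕ) (hl : 2 ≤ l) (i : Fin l → α) (j : Fin l → β),
          Function.Injective i ∧ Function.Injective j ∧
          ∀ t, (i t, j t) ∈ S ∧ (i (t + ⟨1, by omega⟩), j t) ∈ S := by
      intro p hp hlt
      have hcp := Finset.card_erase_add_one hp
      have h1 := (hS.image Prod.fst).card_pos
      have h2 := (hS.image Prod.snd).card_pos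
      obtain ⟨l, hl, i, j, hi, hj, h⟩ := ih (S.erase p) (Finset.erase_ssubset hp)
        (Finset.card_pos.1 (by omega)) (by omega)
      exact ⟨l, hl, i, j, hi, hj, fun t =>
        ⟨Finset.mem_of_mem_erase (h t).1, Finset.mem_of_mem_erase (h t).2⟩⟩
    by_cases hrow : ∀ p ∈ S, ∃ y, y ≠ p.2 ∧ (p.1, y) ∈ S
    · by_cases hcol : ∀ p ∈ S, ∃ x, x ≠ p.1 ∧ (x, p.2) ∈ S
      · exact exists_cycle_of_no_leaf hS hrow hcol
      · push Not at hcol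
        obtain ⟨p, hp, hleaf⟩ := hcol
        refine herase p hp (add_lt_add_of_le_of_lt
          (Finset.card_le_card (Finset.image_subset_image (Finset.erase_subset _ _)))
          (Finset.card_lt_card ((Finset.ssubset_iff_of_subset
            (Finset.image_subset_image (Finset.erase_subset _ _))).2
              ⟨p.2, Finset.mem_image_of_mem _ hp, ?_⟩)))
        rintro hmem
        obtain ⟨⟨x, y⟩, hq, rfl : y = p.2⟩ := Finset.mem_image.1 hmem
        obtain ⟨hne, hqS⟩ := Finset.mem_erase.1 hq
        exact hleaf x (fun h => hne (Prod.ext h rfl)) hqS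
    · push Not at hrow
      obtain ⟨p, hp, hleaf⟩ := hrow
      refine herase p hp (add_lt_add_of_lt_of_le
        (Finset.card_lt_card ((Finset.ssubset_iff_of_subset
          (Finset.image_subset_image (Finset.erase_subset _ _))).2
            ⟨p.1, Finset.mem_image_of_mem _ hp, ?_⟩))
        (Finset.card_le_card (Finset.image_subset_image (Finset.erase_subset _ _))))
      rintro hmem
      obtain ⟨⟨x, y⟩, hq, rfl : x = p.1⟩ := Finset.mem_image.1 hmem
      obtain ⟨hne, hqS⟩ := Finset.mem_erase.1 hq
      exact hleaf y (fun h => hne (Prod.ext rfl h)) hqS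

/-- If rows and columns are assigned pairwise distinct incident edges, then there are at least as
many edges as vertices. -/
theorem card_add_card_le_of_incident {α β : Type*} [Fintype α] [Fintype β] {S : Finset (α × β)}
    (r : α → β) (c : β → α) (hr : ∀ x, (x, r x) ∈ S) (hc : ∀ y, (c y, y) ∈ S)
    (hcr : ∀ x, c (r x) ≠ x) : Fintype.card α + Fintype.card β ≤ S.card := by
  rw [← Fintype.card_sum, ← Finset.card_univ]
  refine Finset.card_le_card_of_injOn (Sum.elim (fun x => (x, r x)) (fun y => (c y, y))) ?_ ?_
  · rintro (x | y) _
    exacts [hr x, hc y]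
  · rintro (x | y) _ (x' | y') _ h <;> simp only [Sum.elim_inl, Sum.elim_inr, Prod.mk.injEq] at h
    · rw [h.1]
    · exact (hcr x (by rw [h.2, ← h.1])).elim
    · exact (hcr x' (by rw [← h.2, h.1])).elim
    · rw [h.2]

/-- A sequence on a cyclic index set with total sum zero is a sequence of differences. -/
theorem exists_cyclic_potential {M : Type*} [AddCommMonoid M] {l : ℕ} (hl : 2 ≤ l) (w : Fin l → M)
    (hw : ∑ t, w t = 0) : ∃ u : Fin l → M, ∀ t, u (t + ⟨1, by omega⟩) = u t + w t := by
  let v : ℕ → M := fun n => if h : n < l then w ⟨n, h⟩ else 0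
  have hv : ∀ t : Fin l, v t = w t := fun t => by simp [v]
  refine ⟨fun t => ∑ s ∈ Finset.range t, v s, fun t => ?_⟩
  dsimp only
  rw [← hv t, ← Finset.sum_range_succ, Fin.val_add]
  dsimp only
  by_cases ht : (t : ℕ) + 1 < l
  · rw [Nat.mod_eq_of_lt ht]
  · rw [show (t : ℕ) + 1 = l by omega, Nat.mod_self, Finset.range_zero,
      Finset.sum_empty, ← Fin.sum_univ_eq_sum_range, ← hw]
    exact (Finset.sum_congr rfl fun s _ => hv s).symm

/-- The input pairs on which the classical strategy `(a, b)` is consistent with `k`. -/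
def satisfied {nA nB d : ℕ} (k : Fin nA → Fin nB → ZMod d)
    (a : Fin nA → ZMod d) (b : Fin nB → ZMod d) : Finset (Fin nA × Fin nB) :=
  Finset.univ.filter fun p => b p.2 = a p.1 + k p.1 p.2

theorem mem_satisfied {nA nB d : ℕ} {k : Fin nA → Fin nB → ZMod d}
    {a : Fin nA → ZMod d} {b : Fin nB → ZMod d} {x : Fin nA} {y : Fin nB} :
    (x, y) ∈ satisfied k a b ↔ b y = a x + k x y := by
  simp [satisfied]

theorem card_satisfied_add_numContr {nA nB d : ℕ} (k : Fin nA → Fin nB → ZMod d)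
    (a : Fin nA → ZMod d) (b : Fin nB → ZMod d) :
    (satisfied k a b).card + numContr k a b = nA * nB := by
  have h := Finset.card_filter_add_card_filter_not (s := (Finset.univ : Finset (Fin nA × Fin nB)))
    (fun p => b p.2 = a p.1 + k p.1 p.2)
  simpa [satisfied, numContr] using h

theorem betaC_le {nA nB d : ℕ} (k : Fin nA → Fin nB → ZMod d)
    (a : Fin nA → ZMod d) (b : Fin nB → ZMod d) : betaC k ≤ numContr k a b :=
  Nat.sInf_le ⟨a, b, rfl⟩

theorem exists_numContr_eq_betaC {nA nB d : ℕ} (k : Fin nA → Fin nB → ZMod d) :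
    ∃ a b, numContr k a b = betaC k :=
  Nat.sInf_mem (s := { m | ∃ a b, numContr k a b = m }) ⟨_, 0, 0, rfl⟩

theorem betaC_le_pred_mul_pred {nA nB d : ℕ} (hA : 0 < nA) (hB : 0 < nB)
    (k : Fin nA → Fin nB → ZMod d) : betaC k ≤ (nA - 1) * (nB - 1) := by
  obtain ⟨m, rfl⟩ : ∃ m, nA = m + 1 := ⟨nA - 1, by omega⟩
  obtain ⟨n, rfl⟩ : ∃ n, nB = n + 1 := ⟨nB - 1, by omega⟩
  refine (betaC_le k (fun x => k 0 0 - k x 0) (fun y => k 0 y)).trans ?_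
  have hsub : (Finset.univ.filter fun p : Fin (m + 1) × Fin (n + 1) =>
      k 0 p.2 ≠ k 0 0 - k p.1 0 + k p.1 p.2) ⊆ ({0}ᶜ : Finset (Fin (m + 1))) ×ˢ {0}ᶜ := by
    rintro ⟨x, y⟩ h
    simp only [Finset.mem_filter, Finset.mem_univ, true_and] at h
    simp only [Finset.mem_product, Finset.mem_compl, Finset.mem_singleton]
    exact ⟨by rintro rfl; simp at h, by rintro rfl; simp at h⟩
  simpa [numContr, Finset.card_product, Finset.card_compl] using Finset.card_le_card hsub

/-- Some strategy is consistent along a good cycle and along one more edge for each input off the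
cycle. -/
theorem exists_le_card_satisfied_of_good_cycle {nA nB d : ℕ} (k : Fin nA → Fin nB → ZMod d)
    {l : ℕ} (hl : 2 ≤ l) {i : Fin l → Fin nA} {j : Fin l → Fin nB}
    (hi : Function.Injective i) (hj : Function.Injective j)
    (hsum : ∑ t : Fin l, k (i t) (j t) = ∑ t : Fin l, k (i (t + ⟨1, by omega⟩)) (j t)) :
    ∃ a b, nA + nB ≤ (satisfied k a b).card := by
  obtain ⟨u, hu⟩ := exists_cyclic_potential hl
    (fun t => k (i t) (j t) - k (i (t + ⟨1, by omega⟩)) (j t))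
    (by rw [Finset.sum_sub_distrib, hsum, sub_self])
  let o : Fin l := ⟨0, by omega⟩
  have hne : ∀ t : Fin l, t + ⟨1, by omega⟩ ≠ t := by
    intro t h
    have h' := congrArg Fin.val h
    rw [Fin.val_add] at h'
    dsimp only at h'
    by_cases ht : (t : ℕ) + 1 < l
    · rw [Nat.mod_eq_of_lt ht] at h'
      omega
    · rw [show (t : ℕ) + 1 = l by omega, Nat.mod_self] at h'
      omega
  let a : Fin nA → ZMod d := Function.extend i u fun x => u o + k (i o) (j o) - k x (j o)
  let b : Fin nB → ZMod d :=
    Function.extend j (fun t => u t + k (i t) (j t)) fun y => u o + k (i o) y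
  let r : Fin nA → Fin nB := Function.extend i j fun _ => j o
  let c : Fin nB → Fin nA := Function.extend j (fun t => i (t + ⟨1, by omega⟩)) fun _ => i o
  have ha : ∀ t, a (i t) = u t := hi.extend_apply _ _
  have hb : ∀ t, b (j t) = u t + k (i t) (j t) := hj.extend_apply _ _
  have hr : ∀ t, r (i t) = j t := hi.extend_apply _ _
  have hc : ∀ t, c (j t) = i (t + ⟨1, by omega⟩) := hj.extend_apply _ _
  refine ⟨a, b, ?_⟩
  have key := card_add_card_le_of_incident (S := satisfied k a b) r c ?_ ?_ ?_
  · simpa using key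
  · intro x
    rw [mem_satisfied]
    by_cases hx : ∃ t, i t = x
    · obtain ⟨t, rfl⟩ := hx
      rw [hr, hb, ha]
    · rw [show r x = j o from Function.extend_apply' _ _ _ hx, hb,
        show a x = _ from Function.extend_apply' _ _ _ hx]
      abel
  · intro y
    rw [mem_satisfied]
    by_cases hy : ∃ t, j t = y
    · obtain ⟨t, rfl⟩ := hy
      rw [hc, hb, ha, hu]
      abel
    · rw [show c y = i o from Function.extend_apply' _ _ _ hy, ha,
        show b y = _ from Function.extend_apply' _ _ _ hy]
  · intro x
    by_cases hx : ∃ t, i t = x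
    · obtain ⟨t, rfl⟩ := hx
      rw [hr, hc]
      exact fun h => hne t (hi h)
    · rw [show r x = j o from Function.extend_apply' _ _ _ hx, hc]
      exact fun h => hx ⟨_, h⟩

/-- Every cycle of consistent input pairs is a good cycle. -/
theorem sum_eq_of_cycle_satisfied {nA nB d : ℕ} {k : Fin nA → Fin nB → ZMod d}
    {a : Fin nA → ZMod d} {b : Fin nB → ZMod d} {l : ℕ} (hl : 2 ≤ l)
    {i : Fin l → Fin nA} {j : Fin l → Fin nB}
    (h : ∀ t, (i t, j t) ∈ satisfied k a b ∧ (i (t + ⟨1, by omega⟩), j t) ∈ satisfied k a b) :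
    ∑ t : Fin l, k (i t) (j t) = ∑ t : Fin l, k (i (t + ⟨1, by omega⟩)) (j t) := by
  have : NeZero l := ⟨by omega⟩
  have h1 : ∀ t, k (i t) (j t) = b (j t) - a (i t) := fun t => by
    rw [mem_satisfied.1 (h t).1, add_sub_cancel_left]
  have h2 : ∀ t, k (i (t + ⟨1, by omega⟩)) (j t) = b (j t) - a (i (t + ⟨1, by omega⟩)) :=
    fun t => by rw [mem_satisfied.1 (h t).2, add_sub_cancel_left]
  simp only [h1, h2, Finset.sum_sub_distrib]
  congr 1
  exact (Equiv.sum_comp (Equiv.addRight (⟨1, by omega⟩ : Fin l)) fun t => a (i t)).symm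

/-- A game matrix has the maximal contradiction number `(n_A − 1)(n_B − 1)` iff it
contains no good cycle: there is no `l ≥ 2`, pairwise distinct rows `i₁,…,i_l` and
pairwise distinct columns `j₁,…,j_l` with
`k(i₁,j₁) + ⋯ + k(i_l,j_l) = k(i₂,j₁) + ⋯ + k(i₁,j_l)` (row indices taken cyclically). -/
theorem betaC_max_iff_no_good_cycle {nA nB d : ℕ} (hA : 2 ≤ nA) (hB : 2 ≤ nB) (hd : 1 ≤ d)
    (k : Fin nA → Fin nB → ZMod d) :
    betaC k = (nA - 1) * (nB - 1) ↔
    ¬ ∃ (l : ℕ) (hl : 2 ≤ l) (i : Fin l → Fin nA) (j : Fin l → Fin nB),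
        Function.Injective i ∧ Function.Injective j ∧
        ∑ t : Fin l, k (i t) (j t) = ∑ t : Fin l, k (i (t + ⟨1, by omega⟩)) (j t) := by
  obtain ⟨m, rfl⟩ : ∃ m, nA = m + 1 := ⟨nA - 1, by omega⟩
  obtain ⟨n, rfl⟩ : ∃ n, nB = n + 1 := ⟨nB - 1, by omega⟩
  have hmul : (m + 1) * (n + 1) = (m + 1 - 1) * (n + 1 - 1) + (m + n + 1) := by
    simp only [Nat.add_sub_cancel]
    ring
  constructor
  · rintro hmax ⟨l, hl, i, j, hi, hj, hsum⟩
    obtain ⟨a, b, hab⟩ := exists_le_card_satisfied_of_good_cycle k hl hi hj hsum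
    have h1 := card_satisfied_add_numContr k a b
    have h2 := betaC_le k a b
    omega
  · intro hno
    refine (betaC_le_pred_mul_pred (by omega) (by omega) k).antisymm (not_lt.1 fun hlt => hno ?_)
    obtain ⟨a, b, hab⟩ := exists_numContr_eq_betaC k
    have h1 := card_satisfied_add_numContr k a b
    have hrows := Finset.card_le_univ ((satisfied k a b).image Prod.fst)
    have hcols := Finset.card_le_univ ((satisfied k a b).image Prod.snd)
    rw [Fintype.card_fin] at hrows hcols
    obtain ⟨l, hl, i, j, hi, hj, h⟩ := exists_cycle_of_card_le (satisfied k a b)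
      (Finset.card_pos.1 (by omega)) (by omega)
    exact ⟨l, hl, i, j, hi, hj, sum_eq_of_cycle_satisfied hl h⟩
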